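/- For every integer n ≥ 1 and i ∈ {1,2}, the Sobolev orthogonal polynomial satisfies 𝒟_i^j Q_n^{(i)}(α) = 𝒟_i^j M_n(α) / (1 + λ K_{n−1}^{(j,j)}(α,α)), where the denominator is strictly positive. -/

import Mathlib

open Finset Filter Topology Polynomial

noncomputable section

/-- Pochhammer symbol `(a)_k = a(a+1)⋯(a+k−1)`. -/
def poch (a : ℝ) (k : ℕ) : ℝ := ∏ m ∈ Finset.range k, (a + m)

/-- Falling factorial `[x]_k = x(x−1)⋯(x−k+1)`. -/
def fall (x : ℝ) (k : ℕ) : ℝ := ∏ m ∈ Finset.range k, (x - m)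

/-- `⟨x⟩_i^k`: falling factorial for `i = 1`, Pochhammer symbol for `i = 2`. -/
def br (i : ℕ) (x : ℝ) (k : ℕ) : ℝ := if i = 1 then fall x k else poch x k

/-- Forward (`i = 1`) resp. backward (`i = 2`) difference operator `𝒟_i`. -/
def Dop (i : ℕ) (f : ℝ → ℝ) : ℝ → ℝ :=
  fun x => if i = 1 then f (x + 1) - f x else f x - f (x - 1)

/-- Iterated difference operator `𝒟_i^k`. -/
def Dk (i k : ℕ) (f : ℝ → ℝ) : ℝ → ℝ := (Dop i)^[k] f

/-- Kronecker delta `δ_{i,m}` (real valued). -/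
def kdelta (i m : ℕ) : ℝ := if i = m then 1 else 0

/-- The shift `x ± 1`: `x + 1` for `i = 1`, `x - 1` for `i = 2`. -/
def sh (i : ℕ) (x : ℝ) : ℝ := if i = 1 then x + 1 else x - 1

/-- Monic Meixner polynomial `M_n(x)`. -/
def MeixnerM (γ μ : ℝ) (n : ℕ) (x : ℝ) : ℝ :=
  poch γ n * (μ / (μ - 1)) ^ n *
    ∑ k ∈ Finset.range (n + 1),
      poch (-(n : ℝ)) k * poch (-x) k / poch γ k * (1 - μ⁻¹) ^ k / (Nat.factorial k : ℝ)

/-- Meixner inner product `⟨p,q⟩ = ∑_{x≥0} p(x)q(x) μ^x (γ)_x / x!`. -/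
def mIP (γ μ : ℝ) (p q : ℝ → ℝ) : ℝ :=
  ∑' x : ℕ, p x * q x * μ ^ x * poch γ x / (Nat.factorial x : ℝ)

/-- Squared Meixner norm `‖M_n‖²`. -/
def nrm2 (γ μ : ℝ) (n : ℕ) : ℝ := mIP γ μ (MeixnerM γ μ n) (MeixnerM γ μ n)

/-- Kernel `K_n^{(l,m)}(x,y)` for the operator `𝒟_i`. -/
def Klm (γ μ : ℝ) (i l m n : ℕ) (x y : ℝ) : ℝ :=
  ∑ k ∈ Finset.range (n + 1),
    Dk i l (MeixnerM γ μ k) x * Dk i m (MeixnerM γ μ k) y / nrm2 γ μ k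

/-- Sobolev inner product `⟨p,q⟩_λ = ⟨p,q⟩ + λ 𝒟_i^j p(α) 𝒟_i^j q(α)`. -/
def sIP (γ μ lam α : ℝ) (i j : ℕ) (p q : ℝ → ℝ) : ℝ :=
  mIP γ μ p q + lam * Dk i j p α * Dk i j q α

/-- `Q` is the monic Sobolev orthogonal polynomial of degree `n`. -/
def IsSobolevOP (γ μ lam α : ℝ) (i j n : ℕ) (Q : Polynomial ℝ) : Prop :=
  Q.Monic ∧ Q.natDegree = n ∧
    ∀ p : Polynomial ℝ, p.degree < (n : WithBot ℕ) →
      sIP γ μ lam α i j (fun x => Q.eval x) (fun x => p.eval x) = 0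

/-- Coefficient `a_n^{(k)}`. -/
def acoef (γ μ lam α : ℝ) (i j n k : ℕ) : ℝ :=
  -(lam * (Nat.factorial j : ℝ) * Dk i j (MeixnerM γ μ n) α * Dk i k (MeixnerM γ μ (n - 1)) α) /
    ((Nat.factorial k : ℝ) * nrm2 γ μ (n - 1) * (1 + lam * Klm γ μ i j j (n - 1) α α))

/-- Coefficient `b_n^{(k)}`. -/
def bcoef (γ μ lam α : ℝ) (i j n k : ℕ) : ℝ :=
  lam * (Nat.factorial j : ℝ) * Dk i j (MeixnerM γ μ n) α * Dk i k (MeixnerM γ μ n) α /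
    ((Nat.factorial k : ℝ) * nrm2 γ μ (n - 1) * (1 + lam * Klm γ μ i j j (n - 1) α α))

/-- Rational function `A_{1,n}(x)`. -/
def A1 (γ μ lam α : ℝ) (i j n : ℕ) (x : ℝ) : ℝ :=
  1 + (1 / br i (x - α) (j + 1)) *
    ∑ k ∈ Finset.range (j + 1), acoef γ μ lam α i j n k * br i (x - α) k

/-- Rational function `B_{1,n}(x)`. -/
def B1 (γ μ lam α : ℝ) (i j n : ℕ) (x : ℝ) : ℝ :=
  (1 / br i (x - α) (j + 1)) *
    ∑ k ∈ Finset.range (j + 1), bcoef γ μ lam α i j n k * br i (x - α) k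

/-- Meixner recurrence coefficient `α_n`. -/
def alphaR (γ μ : ℝ) (n : ℕ) : ℝ := ((n : ℝ) * (1 + μ) + μ * γ) / (1 - μ)

/-- Meixner recurrence coefficient `β_n`. -/
def betaR (γ μ : ℝ) (n : ℕ) : ℝ := (n : ℝ) * μ * ((n : ℝ) + γ - 1) / (1 - μ) ^ 2

/-- Rational function `A_{2,n}(x)`. -/
def A2 (γ μ lam α : ℝ) (i j n : ℕ) (x : ℝ) : ℝ :=
  -(B1 γ μ lam α i j (n - 1) x) / betaR γ μ (n - 1)

/-- Rational function `B_{2,n}(x)`. -/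
def B2 (γ μ lam α : ℝ) (i j n : ℕ) (x : ℝ) : ℝ :=
  A1 γ μ lam α i j (n - 1) x + A2 γ μ lam α i j n x * (alphaR γ μ (n - 1) - x)

/-- Rational function `C_{1,n}(x)`. -/
def C1 (γ μ lam α : ℝ) (i j n : ℕ) (x : ℝ) : ℝ :=
  (x + γ * kdelta i 1) * Dop i (A1 γ μ lam α i j n) x + (n : ℝ) * A1 γ μ lam α i j n (sh i x)
    - ((n : ℝ) - 1) * ((n : ℝ) + γ - 2) * μ ^ kdelta i 2 * B1 γ μ lam α i j n (sh i x) /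
        (betaR γ μ (n - 1) * (1 - μ))

/-- Rational function `D_{1,n}(x)`. -/
def D1 (γ μ lam α : ℝ) (i j n : ℕ) (x : ℝ) : ℝ :=
  (x + γ * kdelta i 1) * Dop i (B1 γ μ lam α i j n) x
    + ((n : ℝ) - 1) * B1 γ μ lam α i j n (sh i x)
    + ((n : ℝ) - 1) * ((n : ℝ) + γ - 2) * (x - alphaR γ μ (n - 1)) * μ ^ kdelta i 2 *
        B1 γ μ lam α i j n (sh i x) / (betaR γ μ (n - 1) * (1 - μ))
    + (n : ℝ) * ((n : ℝ) + γ - 1) * μ ^ kdelta i 2 * A1 γ μ lam α i j n (sh i x) / (1 - μ)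

/-- Rational function `C_{2,n}(x)`. -/
def C2 (γ μ lam α : ℝ) (i j n : ℕ) (x : ℝ) : ℝ :=
  -(D1 γ μ lam α i j (n - 1) x) / betaR γ μ (n - 1)

/-- Rational function `D_{2,n}(x)`. -/
def D2 (γ μ lam α : ℝ) (i j n : ℕ) (x : ℝ) : ℝ :=
  C1 γ μ lam α i j (n - 1) x + C2 γ μ lam α i j n x * (alphaR γ μ (n - 1) - x)

/-- `A_{m,n}(x)` for `m = 1, 2`. -/
def Aa (γ μ lam α : ℝ) (i j n m : ℕ) (x : ℝ) : ℝ :=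
  if m = 1 then A1 γ μ lam α i j n x else A2 γ μ lam α i j n x

/-- `B_{m,n}(x)` for `m = 1, 2`. -/
def Bb (γ μ lam α : ℝ) (i j n m : ℕ) (x : ℝ) : ℝ :=
  if m = 1 then B1 γ μ lam α i j n x else B2 γ μ lam α i j n x

/-- `C_{k,n}(x)` for `k = 1, 2`. -/
def Cc (γ μ lam α : ℝ) (i j n k : ℕ) (x : ℝ) : ℝ :=
  if k = 1 then C1 γ μ lam α i j n x else C2 γ μ lam α i j n x

/-- `D_{k,n}(x)` for `k = 1, 2`. -/
def Dd (γ μ lam α : ℝ) (i j n k : ℕ) (x : ℝ) : ℝ :=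
  if k = 1 then D1 γ μ lam α i j n x else D2 γ μ lam α i j n x

/-- `Λ_{m,n}^{(k)}(x) = (−1)^k (C_{k,n}(x) B_{m,n}(x) − A_{m,n}(x) D_{k,n}(x))`. -/
def Lam (γ μ lam α : ℝ) (i j n m k : ℕ) (x : ℝ) : ℝ :=
  (-1 : ℝ) ^ k * (Cc γ μ lam α i j n k x * Bb γ μ lam α i j n m x
    - Aa γ μ lam α i j n m x * Dd γ μ lam α i j n k x)

/-- `Θ_n(x) = A_{1,n}(x) B_{2,n}(x) − B_{1,n}(x) A_{2,n}(x)`. -/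
def Theta (γ μ lam α : ℝ) (i j n : ℕ) (x : ℝ) : ℝ :=
  A1 γ μ lam α i j n x * B2 γ μ lam α i j n x - B1 γ μ lam α i j n x * A2 γ μ lam α i j n x

/-- `Θ̃_n(x) = (x + γ δ_{i,1}) Θ_n(x)`. -/
def Thetatil (γ μ lam α : ℝ) (i j n : ℕ) (x : ℝ) : ℝ :=
  (x + γ * kdelta i 1) * Theta γ μ lam α i j n x
theorem poch_succ (a : ℝ) (k : ℕ) : poch a (k + 1) = poch a k * (a + k) :=
  Finset.prod_range_succ _ _

theorem poch_add (a : ℝ) (k m : ℕ) : poch a (k + m) = poch a k * poch (a + k) m := by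
  simp only [poch, Finset.prod_range_add]
  congr 1
  refine Finset.prod_congr rfl fun x _ => ?_
  push_cast; ring

theorem poch_succ' (a : ℝ) (k : ℕ) : poch a (k + 1) = a * poch (a + 1) k := by
  rw [add_comm k 1, poch_add]
  simp [poch]

theorem poch_pos {a : ℝ} (ha : 0 < a) (k : ℕ) : 0 < poch a k :=
  Finset.prod_pos fun _ _ => by positivity

theorem poch_neg_eq_fall (x : ℝ) (k : ℕ) : poch (-x) k = (-1) ^ k * fall x k := by
  simp only [poch, fall]
  rw [← Finset.card_range k, ← Finset.prod_const, Finset.card_range, ← Finset.prod_mul_distrib]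
  exact Finset.prod_congr rfl fun _ _ => by ring

theorem fall_natCast (n k : ℕ) : fall n k = n.descFactorial k := by
  induction k with
  | zero => simp [fall]
  | succ k ih =>
    rw [Nat.descFactorial_succ, fall, Finset.prod_range_succ, ← fall, ih]
    rcases le_or_gt k n with h | h
    · push_cast [h]; ring
    · simp [Nat.descFactorial_of_lt h]

theorem poch_neg_natCast (n k : ℕ) :
    poch (-(n : ℝ)) k = (-1) ^ k * ((k.factorial : ℝ) * n.choose k) := by
  rw [poch_neg_eq_fall, fall_natCast, Nat.descFactorial_eq_factorial_mul_choose]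
  push_cast; ring

/-- Weight `μ^x (a)_x / x!` of the Meixner inner product. -/
def meixnerWeight (a μ : ℝ) (x : ℕ) : ℝ := μ ^ x * poch a x / (x.factorial : ℝ)

theorem meixnerWeight_pos {a μ : ℝ} (ha : 0 < a) (hμ : 0 < μ) (x : ℕ) :
    0 < meixnerWeight a μ x := by
  have := poch_pos ha x
  unfold meixnerWeight; positivity

theorem poch_le_factorial_mul_choose {a : ℝ} (ha : 0 < a) {N : ℕ} (haN : a ≤ N) (x : ℕ) :
    poch a x ≤ x.factorial * (x + N).choose N := by
  induction x with
  | zero => simp [poch]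
  | succ x ih =>
    have h := Nat.choose_mul_succ_eq (x + N) N
    rw [show x + N + 1 - N = x + 1 by omega] at h
    have h' : ((x + N).choose N : ℝ) * (x + N + 1) = (x + 1 + N).choose N * (x + 1) := by
      rw [show x + 1 + N = x + N + 1 by omega]; exact_mod_cast h
    calc poch a (x + 1) = poch a x * (a + x) := poch_succ a x
      _ ≤ (x.factorial * (x + N).choose N) * (x + N + 1) := by
        exact mul_le_mul ih (by linarith) (by positivity) (by positivity)
      _ = (x + 1).factorial * (x + 1 + N).choose N := by
        rw [mul_assoc, h', Nat.factorial_succ]; push_cast; ring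

theorem summable_meixnerWeight {a μ : ℝ} (ha : 0 < a) (hμ0 : 0 < μ) (hμ1 : μ < 1) :
    Summable (meixnerWeight a μ) := by
  obtain ⟨N, hN⟩ := exists_nat_ge a
  refine Summable.of_nonneg_of_le (fun x => (meixnerWeight_pos ha hμ0 x).le) (fun x => ?_)
    (summable_choose_mul_geometric_of_norm_lt_one (R := ℝ) N (r := μ) (by
      rwa [Real.norm_of_nonneg hμ0.le]))
  rw [meixnerWeight, div_le_iff₀ (by positivity)]
  calc μ ^ x * poch a x ≤ μ ^ x * (x.factorial * (x + N).choose N) := by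
        gcongr; exact poch_le_factorial_mul_choose ha hN x
    _ = _ := by ring

theorem poch_mul_meixnerWeight (a μ : ℝ) (m x : ℕ) :
    poch (a + x) m * meixnerWeight a μ x = poch a m * meixnerWeight (a + m) μ x := by
  have h : poch a x * poch (a + x) m = poch a m * poch (a + m) x := by
    rw [← poch_add, ← poch_add, add_comm]
  unfold meixnerWeight
  linear_combination μ ^ x / (x.factorial : ℝ) * h

theorem summable_eval_mul_meixnerWeight {a μ : ℝ} (ha : 0 < a) (hμ0 : 0 < μ) (hμ1 : μ < 1)
    (p : ℝ[X]) : Summable fun x : ℕ => p.eval (x : ℝ) * meixnerWeight a μ x := by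
  have hpow (d : ℕ) : Summable fun x : ℕ => (x : ℝ) ^ d * meixnerWeight a μ x := by
    refine Summable.of_nonneg_of_le
      (fun x => mul_nonneg (by positivity) (meixnerWeight_pos ha hμ0 x).le) (fun x => ?_)
      ((summable_meixnerWeight (a := a + d) (by positivity) hμ0 hμ1).mul_left (poch a d))
    rw [← poch_mul_meixnerWeight]
    refine mul_le_mul_of_nonneg_right ?_ (meixnerWeight_pos ha hμ0 x).le
    calc (x : ℝ) ^ d = ∏ _m ∈ Finset.range d, (x : ℝ) := by simp
      _ ≤ poch (a + x) d := Finset.prod_le_prod (fun _ _ => by positivity) fun m _ => by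
        have : (0 : ℝ) ≤ m := m.cast_nonneg
        linarith
  induction p using Polynomial.induction_on' with
  | add p q hp hq => simpa [add_mul] using hp.add hq
  | monomial d c => simpa [mul_assoc] using (hpow d).mul_left c

theorem tsum_meixnerWeight {a μ : ℝ} (ha : 0 < a) (hμ0 : 0 < μ) (hμ1 : μ < 1) :
    ∑' x, meixnerWeight a μ x = (1 - μ) * ∑' x, meixnerWeight (a + 1) μ x := by
  have hs := summable_meixnerWeight (a := a + 1) (by positivity) hμ0 hμ1
  have hstep (x : ℕ) : meixnerWeight a μ (x + 1) =
      meixnerWeight (a + 1) μ (x + 1) - μ * meixnerWeight (a + 1) μ x := by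
    unfold meixnerWeight
    rw [poch_succ', poch_succ, Nat.factorial_succ]
    push_cast
    field_simp
    ring
  have h0 : meixnerWeight a μ 0 = meixnerWeight (a + 1) μ 0 := by simp [meixnerWeight, poch]
  have h1 := hs.tsum_eq_zero_add
  rw [(summable_meixnerWeight ha hμ0 hμ1).tsum_eq_zero_add, h0]
  simp_rw [hstep]
  rw [((summable_nat_add_iff 1).2 hs).tsum_sub (hs.mul_left μ), tsum_mul_left]
  linarith

theorem tsum_meixnerWeight_add {a μ : ℝ} (ha : 0 < a) (hμ0 : 0 < μ) (hμ1 : μ < 1) (r : ℕ) :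
    ∑' x, meixnerWeight (a + r) μ x = (∑' x, meixnerWeight a μ x) / (1 - μ) ^ r := by
  have hμ : 1 - μ ≠ 0 := by linarith
  induction r with
  | zero => simp
  | succ r ih =>
    have h := tsum_meixnerWeight (a := a + r) (by positivity) hμ0 hμ1
    rw [ih] at h
    push_cast
    rw [← add_assoc, pow_succ, ← div_div, h]
    field_simp

/-- The positive linear functional on polynomials defined by the Meixner weight. -/
def meixnerFunctional {γ μ : ℝ} (hγ : 0 < γ) (hμ0 : 0 < μ) (hμ1 : μ < 1) : ℝ[X] →ₗ[ℝ] ℝ where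
  toFun p := ∑' x : ℕ, p.eval (x : ℝ) * meixnerWeight γ μ x
  map_add' p q := by
    simp only [Polynomial.eval_add, add_mul]
    exact (summable_eval_mul_meixnerWeight hγ hμ0 hμ1 p).tsum_add
      (summable_eval_mul_meixnerWeight hγ hμ0 hμ1 q)
  map_smul' c p := by
    simp only [Polynomial.eval_smul, smul_eq_mul, mul_assoc, tsum_mul_left, RingHom.id_apply]

theorem mIP_eval {γ μ : ℝ} (hγ : 0 < γ) (hμ0 : 0 < μ) (hμ1 : μ < 1) (p q : ℝ[X]) :
    mIP γ μ (fun x => p.eval x) (fun x => q.eval x) = meixnerFunctional hγ hμ0 hμ1 (p * q) := by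
  refine tsum_congr fun x => ?_
  simp only [Polynomial.eval_mul, meixnerWeight]
  ring

theorem meixnerFunctional_self_pos {γ μ : ℝ} (hγ : 0 < γ) (hμ0 : 0 < μ) (hμ1 : μ < 1)
    {p : ℝ[X]} (hp : p ≠ 0) : 0 < meixnerFunctional hγ hμ0 hμ1 (p * p) := by
  obtain ⟨x, hx⟩ : ∃ x : ℕ, p.eval (x : ℝ) ≠ 0 := by
    by_contra! h
    refine hp (p.eq_zero_of_infinite_isRoot
      ((Set.infinite_range_of_injective (Nat.cast_injective (R := ℝ))).mono ?_))
    rintro _ ⟨x, rfl⟩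
    exact h x
  have hw := meixnerWeight_pos hγ hμ0
  refine (summable_eval_mul_meixnerWeight hγ hμ0 hμ1 (p * p)).tsum_pos (fun y => ?_) x ?_
  · rw [Polynomial.eval_mul]
    exact mul_nonneg (mul_self_nonneg _) (hw y).le
  · rw [Polynomial.eval_mul]
    exact mul_pos (mul_self_pos.2 hx) (hw x)

/-- A monic sequence with one polynomial per degree spans the polynomials of bounded degree. -/
theorem mem_of_monic_mem {V : Submodule ℝ ℝ[X]} {B : ℕ → ℝ[X]} (hB : ∀ m, (B m).Monic)
    (hd : ∀ m, (B m).natDegree = m) {n : ℕ} (hV : ∀ m < n, B m ∈ V) {p : ℝ[X]}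
    (hp : p.degree < n) : p ∈ V := by
  induction n generalizing p with
  | zero =>
    rw [Polynomial.degree_lt_iff_coeff_zero] at hp
    have : p = 0 := by ext k; simp [hp k]
    exact this ▸ V.zero_mem
  | succ n ih =>
    have hq : p - p.coeff n • B n ∈ V := by
      refine ih (fun m hm => hV m (by omega)) ?_
      rw [Polynomial.degree_lt_iff_coeff_zero] at hp ⊢
      intro k hk
      rcases hk.eq_or_lt with rfl | hk
      · have : (B n).coeff n = 1 := by simpa [hd n] using (hB n).coeff_natDegree
        simp [this]
      · have : (B n).coeff k = 0 := Polynomial.coeff_eq_zero_of_natDegree_lt (by rwa [hd n])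
        simp [this, hp k hk]
    simpa using V.add_mem hq (V.smul_mem (p.coeff n) (hV n (by omega)))

/-- The falling factorial `[X]_k` as a polynomial. -/
def fallPoly (k : ℕ) : ℝ[X] := ∏ m ∈ Finset.range k, (X - C (m : ℝ))

/-- The shifted Pochhammer symbol `(X + a)_k` as a polynomial. -/
def pochPoly (a : ℝ) (k : ℕ) : ℝ[X] := ∏ m ∈ Finset.range k, (X - C (-(a + m)))

theorem fallPoly_monic (k : ℕ) : (fallPoly k).Monic :=
  Polynomial.monic_prod_X_sub_C _ _

theorem fallPoly_natDegree (k : ℕ) : (fallPoly k).natDegree = k := by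
  simp only [fallPoly, Polynomial.natDegree_finsetProd_X_sub_C_eq_card, Finset.card_range]

theorem pochPoly_monic (a : ℝ) (k : ℕ) : (pochPoly a k).Monic :=
  Polynomial.monic_prod_X_sub_C _ _

theorem pochPoly_natDegree (a : ℝ) (k : ℕ) : (pochPoly a k).natDegree = k := by
  simp only [pochPoly, Polynomial.natDegree_finsetProd_X_sub_C_eq_card, Finset.card_range]

theorem fallPoly_eval (k : ℕ) (x : ℝ) : (fallPoly k).eval x = fall x k := by
  simp [fallPoly, fall, Polynomial.eval_prod]

theorem pochPoly_eval (a : ℝ) (k : ℕ) (x : ℝ) : (pochPoly a k).eval x = poch (a + x) k := by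
  simp only [pochPoly, poch, Polynomial.eval_prod]
  refine Finset.prod_congr rfl fun m _ => ?_
  simp; ring

theorem meixnerFunctional_fall_mul_poch {γ μ : ℝ} (hγ : 0 < γ) (hμ0 : 0 < μ) (hμ1 : μ < 1)
    (k m : ℕ) : meixnerFunctional hγ hμ0 hμ1 (fallPoly k * pochPoly γ m) =
      μ ^ k * poch γ (k + m) * ((∑' x, meixnerWeight γ μ x) / (1 - μ) ^ (k + m)) := by
  rw [← tsum_meixnerWeight_add hγ hμ0 hμ1]
  change ∑' x : ℕ, _ = _
  have hs := summable_eval_mul_meixnerWeight hγ hμ0 hμ1 (fallPoly k * pochPoly γ m)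
  rw [← hs.sum_add_tsum_nat_add k, Finset.sum_eq_zero, zero_add, ← tsum_mul_left]
  · refine tsum_congr fun x => ?_
    have hf : (x.factorial : ℝ) * fall ((x + k : ℕ) : ℝ) k = (x + k).factorial := by
      rw [fall_natCast]
      have := Nat.factorial_mul_descFactorial (n := x + k) (k := k) (by omega)
      rw [Nat.add_sub_cancel] at this
      exact_mod_cast this
    have hpoch : poch γ (x + k) * poch (γ + (x + k : ℕ)) m =
        poch γ (k + m) * poch (γ + (k + m : ℕ)) x := by
      rw [← poch_add, ← poch_add]; congr 1; omega
    have h1 : (x.factorial : ℝ) ≠ 0 := by positivity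
    have h2 : ((x + k).factorial : ℝ) ≠ 0 := by positivity
    rw [Polynomial.eval_mul, fallPoly_eval, pochPoly_eval, meixnerWeight, meixnerWeight, pow_add]
    field_simp
    linear_combination (poch γ (x + k) * poch (γ + (x + k : ℕ)) m) * hf +
      (x + k).factorial * hpoch
  · intro x hx
    rw [Polynomial.eval_mul, fallPoly_eval, fall_natCast,
      Nat.descFactorial_of_lt (Finset.mem_range.1 hx)]
    simp

/-- Coefficient of the falling factorial `[x]_k` in the monic Meixner polynomial `M_n(x)`. -/
def meixnerCoeff (γ μ : ℝ) (n k : ℕ) : ℝ :=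
  poch γ n * (μ / (μ - 1)) ^ n * (n.choose k / poch γ k * (1 - μ⁻¹) ^ k)

/-- The monic Meixner polynomial. -/
def meixnerPoly (γ μ : ℝ) (n : ℕ) : ℝ[X] :=
  ∑ k ∈ Finset.range (n + 1), meixnerCoeff γ μ n k • fallPoly k

theorem meixnerPoly_eval (γ μ : ℝ) (n : ℕ) :
    (fun x => (meixnerPoly γ μ n).eval x) = MeixnerM γ μ n := by
  funext x
  simp only [meixnerPoly, MeixnerM, Polynomial.eval_finsetSum, Polynomial.eval_smul,
    fallPoly_eval, smul_eq_mul, Finset.mul_sum]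
  refine Finset.sum_congr rfl fun k _ => ?_
  have h1 : ((-1 : ℝ) ^ k) * (-1) ^ k = 1 := by rw [← mul_pow]; simp
  have h2 : (k.factorial : ℝ) ≠ 0 := by positivity
  rw [poch_neg_natCast, poch_neg_eq_fall, meixnerCoeff]
  field_simp
  rw [pow_right_comm]
  simp

theorem meixnerPoly_eq_add {γ μ : ℝ} (hγ : 0 < γ) (hμ0 : 0 < μ) (hμ1 : μ < 1) (n : ℕ) :
    meixnerPoly γ μ n =
      fallPoly n + ∑ k ∈ Finset.range n, meixnerCoeff γ μ n k • fallPoly k := by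
  have h1 : meixnerCoeff γ μ n n = 1 := by
    have hp := (poch_pos hγ n).ne'
    have hm : μ / (μ - 1) * (1 - μ⁻¹) = 1 := by
      have : μ - 1 ≠ 0 := by linarith
      field_simp
    calc meixnerCoeff γ μ n n
        = (poch γ n / poch γ n) * (μ / (μ - 1) * (1 - μ⁻¹)) ^ n := by
          rw [meixnerCoeff, mul_pow, Nat.choose_self]; push_cast; ring
      _ = 1 := by rw [hm, div_self hp, one_pow, one_mul]
  rw [meixnerPoly, Finset.sum_range_succ, h1, one_smul, add_comm]

theorem degree_sum_smul_lt {n : ℕ} {B : ℕ → ℝ[X]} (hd : ∀ k, (B k).natDegree = k) (c : ℕ → ℝ) :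
    (∑ k ∈ Finset.range n, c k • B k).degree < n := by
  rw [← Polynomial.mem_degreeLT]
  refine Submodule.sum_mem _ fun k hk => Submodule.smul_mem _ _ ?_
  rw [Polynomial.mem_degreeLT]
  refine Polynomial.degree_le_natDegree.trans_lt ?_
  rw [hd k]
  exact_mod_cast Finset.mem_range.1 hk

theorem meixnerPoly_monic_natDegree {γ μ : ℝ} (hγ : 0 < γ) (hμ0 : 0 < μ) (hμ1 : μ < 1) (n : ℕ) :
    (meixnerPoly γ μ n).Monic ∧ (meixnerPoly γ μ n).natDegree = n := by
  have hlt : (∑ k ∈ Finset.range n, meixnerCoeff γ μ n k • fallPoly k).degree <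
      (fallPoly n).degree := by
    rw [Polynomial.degree_eq_natDegree (fallPoly_monic n).ne_zero, fallPoly_natDegree]
    exact degree_sum_smul_lt fallPoly_natDegree _
  rw [meixnerPoly_eq_add hγ hμ0 hμ1]
  refine ⟨(fallPoly_monic n).add_of_left hlt, ?_⟩
  rw [Polynomial.natDegree_add_eq_left_of_degree_lt hlt, fallPoly_natDegree]

theorem sum_alternating_choose_poch (a : ℝ) {m n : ℕ} (h : m < n) :
    ∑ k ∈ Finset.range (n + 1), (-1 : ℝ) ^ k * n.choose k * poch (a + k) m = 0 := by
  have h0 := congrFun (Polynomial.fwdDiff_iter_eq_zero_of_degree_lt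
    (P := pochPoly 0 m) (n := n) (by rwa [pochPoly_natDegree])) a
  rw [fwdDiff_iter_eq_sum_shift] at h0
  have h1 : (-1 : ℝ) ^ n * ∑ k ∈ Finset.range (n + 1),
      (((-1 : ℤ) ^ (n - k) * n.choose k) • (pochPoly 0 m).eval (a + k • (1 : ℝ))) = 0 := by
    rw [h0]; simp
  rw [← h1, Finset.mul_sum]
  refine Finset.sum_congr rfl fun k hk => ?_
  have hk : k ≤ n := by simpa [Nat.lt_succ_iff] using hk
  have hs : (-1 : ℝ) ^ n * (-1) ^ (n - k) = (-1) ^ k := by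
    obtain ⟨d, rfl⟩ := Nat.exists_eq_add_of_le hk
    rw [Nat.add_sub_cancel_left, pow_add, mul_assoc, ← mul_pow]
    simp
  rw [pochPoly_eval, zsmul_eq_mul, ← hs]
  simp
  ring

theorem meixnerFunctional_meixnerPoly_mul {γ μ : ℝ} (hγ : 0 < γ) (hμ0 : 0 < μ) (hμ1 : μ < 1)
    {n : ℕ} {p : ℝ[X]} (hp : p.degree < n) :
    meixnerFunctional hγ hμ0 hμ1 (meixnerPoly γ μ n * p) = 0 := by
  suffices p ∈ LinearMap.ker
      ((meixnerFunctional hγ hμ0 hμ1).comp (LinearMap.mulLeft ℝ (meixnerPoly γ μ n))) by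
    simpa using this
  refine mem_of_monic_mem (pochPoly_monic γ) (pochPoly_natDegree γ) (fun m hm => ?_) hp
  rw [LinearMap.mem_ker, LinearMap.comp_apply, LinearMap.mulLeft_apply, meixnerPoly,
    Finset.sum_mul, map_sum]
  simp only [smul_mul_assoc, map_smul, meixnerFunctional_fall_mul_poch, smul_eq_mul]
  set S := ∑' x, meixnerWeight γ μ x
  have h0 := sum_alternating_choose_poch γ hm
  rw [← mul_zero (poch γ n * (μ / (μ - 1)) ^ n * (S / (1 - μ) ^ m)), ← h0, Finset.mul_sum]
  refine Finset.sum_congr rfl fun k _ => ?_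
  have hμ : 1 - μ ≠ 0 := by linarith
  have hp := (poch_pos hγ k).ne'
  have hpow : (1 - μ⁻¹) ^ k * μ ^ k / (1 - μ) ^ k = (-1) ^ k := by
    rw [← mul_pow, ← div_pow]
    congr 1
    field_simp
    ring
  rw [meixnerCoeff, poch_add, ← hpow, pow_add]
  field_simp

/-- The functional `p ↦ 𝒟_i^j p(α)` on polynomials. -/
def differenceAt (i j : ℕ) (α : ℝ) : ℝ[X] →ₗ[ℝ] ℝ :=
  let D : (ℝ → ℝ) →ₗ[ℝ] (ℝ → ℝ) :=
    { toFun := Dop i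
      map_add' := fun f g => by
        funext x; simp only [Dop, Pi.add_apply]; split_ifs <;> ring
      map_smul' := fun c f => by
        funext x
        simp only [Dop, Pi.smul_apply, smul_eq_mul, RingHom.id_apply]
        split_ifs <;> ring }
  let ev : ℝ[X] →ₗ[ℝ] (ℝ → ℝ) := LinearMap.pi fun x => Polynomial.leval x
  (LinearMap.proj α).comp ((D ^ j).comp ev)

theorem differenceAt_apply (i j : ℕ) (α : ℝ) (p : ℝ[X]) :
    differenceAt i j α p = Dk i j (fun x => p.eval x) α := by
  simp only [differenceAt, LinearMap.comp_apply, Module.End.pow_apply]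
  rfl

/-- `𝒟_i^j Q_n^{(i)}(α) = 𝒟_i^j M_n(α) / (1 + λ K_{n−1}^{(j,j)}(α,α))`. -/
theorem sobolev_jth_difference_at_alpha (γ μ lam α : ℝ) (hγ : 0 < γ) (hμ0 : 0 < μ)
    (hμ1 : μ < 1) (hlam : 0 < lam) (hα : α ≤ 0) (j i n : ℕ) (hi : i = 1 ∨ i = 2)
    (hn : 1 ≤ n) (Q : Polynomial ℝ) (hQ : IsSobolevOP γ μ lam α i j n Q) :
    0 < 1 + lam * Klm γ μ i j j (n - 1) α α ∧
    Dk i j (fun x => Q.eval x) α =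
      Dk i j (MeixnerM γ μ n) α / (1 + lam * Klm γ μ i j j (n - 1) α α) := by
  have hMd := fun k => (meixnerPoly_monic_natDegree hγ hμ0 hμ1 k).2
  have hMm := fun k => (meixnerPoly_monic_natDegree hγ hμ0 hμ1 k).1
  set L := meixnerFunctional hγ hμ0 hμ1 with hL
  set δ := differenceAt i j α with hδ
  set M := meixnerPoly γ μ with hM
  have hDM (k : ℕ) : Dk i j (MeixnerM γ μ k) α = δ (M k) := by
    rw [hδ, differenceAt_apply, meixnerPoly_eval]
  have hnrm (k : ℕ) : nrm2 γ μ k = L (M k * M k) := by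
    rw [nrm2, ← meixnerPoly_eval, mIP_eval hγ hμ0 hμ1]
  have hpos (k : ℕ) : 0 < L (M k * M k) :=
    meixnerFunctional_self_pos hγ hμ0 hμ1 (hMm k).ne_zero
  have horth {k l : ℕ} (h : k ≠ l) : L (M k * M l) = 0 := by
    have hlt {a b : ℕ} (hab : a < b) : (M a).degree < b := by
      rw [Polynomial.degree_eq_natDegree (hMm a).ne_zero, hMd a]
      exact_mod_cast hab
    rcases h.lt_or_gt with h | h
    · rw [mul_comm]; exact meixnerFunctional_meixnerPoly_mul hγ hμ0 hμ1 (hlt h)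
    · exact meixnerFunctional_meixnerPoly_mul hγ hμ0 hμ1 (hlt h)
  have hK : Klm γ μ i j j (n - 1) α α =
      ∑ k ∈ Finset.range n, δ (M k) * δ (M k) / L (M k * M k) := by
    simp only [Klm, hDM, hnrm, Nat.sub_add_cancel hn]
  have hden : 0 < 1 + lam * Klm γ μ i j j (n - 1) α α := by
    have : 0 ≤ Klm γ μ i j j (n - 1) α α := by
      rw [hK]
      exact Finset.sum_nonneg fun k _ => div_nonneg (mul_self_nonneg _) (hpos k).le
    positivity
  refine ⟨hden, ?_⟩
  obtain ⟨hQm, hQd, hQo⟩ := hQ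
  have hQL {p : ℝ[X]} (hp : p.degree < n) : L (Q * p) = -(lam * δ Q * δ p) := by
    have := hQo p hp
    rw [sIP, mIP_eval hγ hμ0 hμ1, ← differenceAt_apply, ← differenceAt_apply] at this
    linarith
  set c : ℕ → ℝ := fun k => lam * δ Q * δ (M k) / L (M k * M k) with hc
  set R : ℝ[X] := Q - M n + ∑ k ∈ Finset.range n, c k • M k with hR
  have hRd : R.degree < n := by
    refine (Polynomial.degree_add_le _ _).trans_lt (max_lt ?_ (degree_sum_smul_lt hMd c))
    have hdQ : Q.degree = n := by rw [Polynomial.degree_eq_natDegree hQm.ne_zero, hQd]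
    have hdM : (M n).degree = n := by
      rw [Polynomial.degree_eq_natDegree (hMm n).ne_zero, hMd n]
    rw [← hdQ]
    exact Polynomial.degree_sub_lt_left (hdQ.trans hdM.symm) hQm.ne_zero
      (hQm.leadingCoeff.trans (hMm n).leadingCoeff.symm)
  have hRM (l : ℕ) (hl : l < n) : L (R * M l) = 0 := by
    have hdl : (M l).degree < n := by
      rw [Polynomial.degree_eq_natDegree (hMm l).ne_zero, hMd l]
      exact_mod_cast hl
    have hsum : ∑ k ∈ Finset.range n, c k * L (M k * M l) = c l * L (M l * M l) :=
      Finset.sum_eq_single_of_mem l (Finset.mem_range.2 hl) fun k _ hk => by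
        rw [horth hk, mul_zero]
    rw [hR, add_mul, sub_mul, Finset.sum_mul, map_add, map_sub, map_sum]
    simp only [smul_mul_assoc, map_smul, smul_eq_mul]
    rw [hsum, hQL hdl, horth hl.ne', hc, div_mul_cancel₀ _ (hpos l).ne']
    ring
  have hR0 : R = 0 := by
    by_contra h
    have hmem : R ∈ LinearMap.ker (L.comp (LinearMap.mulLeft ℝ R)) :=
      mem_of_monic_mem hMm hMd (fun m hm => by simpa using hRM m hm) hRd
    exact (meixnerFunctional_self_pos hγ hμ0 hμ1 h).ne' (by simpa using hmem)
  have hfin : δ R = 0 := by rw [hR0, map_zero]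
  rw [hR, map_add, map_sub, map_sum] at hfin
  have hsum : ∑ k ∈ Finset.range n, δ (c k • M k) =
      lam * δ Q * Klm γ μ i j j (n - 1) α α := by
    rw [hK, Finset.mul_sum]
    refine Finset.sum_congr rfl fun k _ => ?_
    rw [map_smul, smul_eq_mul, hc]
    ring
  rw [← differenceAt_apply, hDM, eq_div_iff hden.ne']
  rw [hsum] at hfin
  linear_combination hfin
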